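/- arXiv:0812.3667 — 3 statements merged into one kernel-verified Lean document; each statement's English description precedes it below -/
import Mathlib

section
/- A bipartite state ρ on A⊗B (dimensions dA, dB) admits a symmetric extension if and only if there exist a finite family of bipartite states ρ_j on A⊗B, each admitting a symmetric extension of rank one (i.e., each pure-extendible), and weights p_j with 0 ≤ p_j ≤ 1 and ∑_j p_j = 1, such that ρ = ∑_j p_j ρ_j. -/
open Matrix Kronecker ComplexOrder

noncomputable section

/-- `σ` is a symmetric extension of the bipartite state `ρ`:
`σ` is PSD, has trace 1, its partial trace over the third factor is `ρ`,
and it is invariant under swapping the two `B` factors. -/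
def IsSymExt {A B : Type*} [Fintype A] [DecidableEq A] [Fintype B] [DecidableEq B]
    (ρ : Matrix (A × B) (A × B) ℂ)
    (σ : Matrix (A × B × B) (A × B × B) ℂ) : Prop :=
  σ.PosSemidef ∧ σ.trace = 1 ∧
  (∀ a a' b b', ∑ c, σ (a, b, c) (a', b', c) = ρ (a, b) (a', b')) ∧
  (∀ a b₁ b₂ a' b₁' b₂', σ (a, b₁, b₂) (a', b₁', b₂') = σ (a, b₂, b₁) (a', b₂', b₁'))

/-- The reduced state on the second factor. -/
def reduceB {A B : Type*} [Fintype A] (ρ : Matrix (A × B) (A × B) ℂ) : Matrix B B ℂ :=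
  fun b b' => ∑ a, ρ (a, b) (a, b')

/-- The multiset of nonzero eigenvalues (with algebraic multiplicity). -/
def nonzeroSpec {n : Type*} [Fintype n] [DecidableEq n] (M : Matrix n n ℂ) : Multiset ℂ :=
  M.charpoly.roots.filter (· ≠ 0)

/-- The largest (real) eigenvalue of a matrix. -/
def lamMax {n : Type*} [Fintype n] [DecidableEq n] (M : Matrix n n ℂ) : ℝ :=
  sSup {x : ℝ | (x : ℂ) ∈ spectrum ℂ M}

/-- `ρ` admits a pure (rank-one) symmetric extension. -/
def PureExt {A B : Type*} [Fintype A] [DecidableEq A] [Fintype B] [DecidableEq B]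
    (ρ : Matrix (A × B) (A × B) ℂ) : Prop :=
  ∃ σ : Matrix (A × B × B) (A × B × B) ℂ, IsSymExt ρ σ ∧ σ.rank = 1

section SymmetricExtension

variable {A B : Type*} [Fintype B]

/-- The partial trace over the third tensor factor. -/
def traceThird (σ : Matrix (A × B × B) (A × B × B) ℂ) : Matrix (A × B) (A × B) ℂ :=
  fun x y => ∑ c, σ (x.1, x.2, c) (y.1, y.2, c)

theorem traceThird_sum_smul {ι : Type*} [Fintype ι] (c : ι → ℂ)
    (σ : ι → Matrix (A × B × B) (A × B × B) ℂ) :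
    traceThird (∑ i, c i • σ i) = ∑ i, c i • traceThird (σ i) := by
  ext x y
  simp only [traceThird, Matrix.sum_apply, Matrix.smul_apply, smul_eq_mul, Finset.mul_sum]
  exact Finset.sum_comm

theorem Matrix.PosSemidef.traceThird {σ : Matrix (A × B × B) (A × B × B) ℂ}
    (h : σ.PosSemidef) : (traceThird σ).PosSemidef := by
  have : _root_.traceThird σ =
      ∑ c, σ.submatrix (fun x : A × B => (x.1, x.2, c)) (fun x => (x.1, x.2, c)) := by
    ext x y
    simp [_root_.traceThird, Matrix.sum_apply]
  rw [this]
  exact posSemidef_sum _ fun c _ => h.submatrix _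

variable [Fintype A]

theorem trace_traceThird (σ : Matrix (A × B × B) (A × B × B) ℂ) :
    (traceThird σ).trace = σ.trace := by
  simp [Matrix.trace, traceThird, Fintype.sum_prod_type]

/-- A swap-invariant positive semidefinite matrix is a sum of rank-one matrices along vectors each of
which is symmetric or antisymmetric under the swap. -/
theorem exists_sum_vecMulVec_of_swap_invariant {σ : Matrix (A × B × B) (A × B × B) ℂ}
    (hσ : σ.PosSemidef)
    (hswap : ∀ a b₁ b₂ a' b₁' b₂',
      σ (a, b₁, b₂) (a', b₁', b₂') = σ (a, b₂, b₁) (a', b₂', b₁')) :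
    ∃ (m : ℕ) (w : Fin m × Fin 2 → A × B × B → ℂ) (ε : Fin 2 → ℂ),
      (∀ s, ε s * star (ε s) = 1) ∧
      (∀ k a b c, w k (a, c, b) = ε k.2 * w k (a, b, c)) ∧
      σ = ∑ k, vecMulVec (w k) (star (w k)) := by
  obtain ⟨m, v, hv⟩ := posSemidef_iff_eq_sum_vecMulVec.mp hσ
  have hε : ∀ s : Fin 2, (![1, -1] s : ℂ) * ![1, -1] s = 1 := by
    intro s; fin_cases s <;> simp
  have hstar : ∀ s : Fin 2, star (![1, -1] s : ℂ) = ![1, -1] s := by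
    intro s; fin_cases s <;> simp
  refine ⟨m, fun k x => (v k.1 x + ![1, -1] k.2 * v k.1 (x.1, x.2.2, x.2.1)) / 2, ![1, -1],
    fun s => by rw [hstar, hε], fun k a b c => ?_, ?_⟩
  · linear_combination (-v k.1 (a, c, b) / 2) * hε k.2
  · ext ⟨a, b₁, b₂⟩ ⟨a', b₁', b₂'⟩
    have h₁ := congr($hv (a, b₁, b₂) (a', b₁', b₂'))
    have h₂ := congr($hv (a, b₂, b₁) (a', b₂', b₁'))
    rw [← hswap] at h₂
    simp only [Matrix.sum_apply, vecMulVec_apply, Pi.star_apply] at h₁ h₂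
    have h₃ : σ (a, b₁, b₂) (a', b₁', b₂') = ∑ i,
        (v i (a, b₁, b₂) * star (v i (a', b₁', b₂')) +
          v i (a, b₂, b₁) * star (v i (a', b₂', b₁'))) / 2 := by
      rw [← Finset.sum_div, Finset.sum_add_distrib, ← h₁, ← h₂]
      ring
    rw [h₃, Matrix.sum_apply, Fintype.sum_prod_type]
    refine Finset.sum_congr rfl fun i _ => ?_
    simp [vecMulVec_apply]
    ring

/-- The squared Euclidean norm of a vector. -/
def sqNorm {n : Type*} [Fintype n] (w : n → ℂ) : ℝ := ∑ x, ‖w x‖ ^ 2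

theorem sqNorm_nonneg {n : Type*} [Fintype n] (w : n → ℂ) : 0 ≤ sqNorm w :=
  Finset.sum_nonneg fun _ _ => by positivity

theorem sqNorm_pos {n : Type*} [Fintype n] {w : n → ℂ} (hw : w ≠ 0) : 0 < sqNorm w := by
  obtain ⟨x, hx⟩ := Function.ne_iff.mp hw
  exact Finset.sum_pos' (fun _ _ => by positivity)
    ⟨x, Finset.mem_univ x, pow_pos (norm_pos_iff.mpr hx) 2⟩

theorem trace_vecMulVec_self_star {n : Type*} [Fintype n] (w : n → ℂ) :
    (vecMulVec w (star w)).trace = (sqNorm w : ℂ) := by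
  simp [Matrix.trace, vecMulVec_apply, sqNorm, Complex.mul_conj']

theorem rank_vecMulVec_eq_one {n : Type*} [Fintype n] {u v : n → ℂ}
    (hu : u ≠ 0) (hv : v ≠ 0) : (vecMulVec u v).rank = 1 := by
  classical
  refine le_antisymm (rank_vecMulVec_le u v) (Nat.one_le_iff_ne_zero.mpr fun h => ?_)
  rw [Matrix.rank, Submodule.finrank_eq_zero, LinearMap.range_eq_bot] at h
  exact vecMulVec_ne_zero hu hv (Matrix.mulVec_injective (by
    rw [← Matrix.coe_mulVecLin, h, ← Matrix.coe_mulVecLin, Matrix.mulVecLin_zero]))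

variable [DecidableEq A] [DecidableEq B]

theorem IsSymExt.traceThird_eq {ρ : Matrix (A × B) (A × B) ℂ}
    {σ : Matrix (A × B × B) (A × B × B) ℂ} (h : IsSymExt ρ σ) : traceThird σ = ρ := by
  ext x y
  exact h.2.2.1 x.1 y.1 x.2 y.2

/-- A convex combination of symmetrically extendible matrices is symmetrically extendible. -/
theorem IsSymExt.sum_smul {ι : Type*} [Fintype ι] {p : ι → ℝ} (hp : ∀ i, 0 ≤ p i)
    (hsum : ∑ i, p i = 1) {ρ : ι → Matrix (A × B) (A × B) ℂ}
    {σ : ι → Matrix (A × B × B) (A × B × B) ℂ} (h : ∀ i, IsSymExt (ρ i) (σ i)) :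
    IsSymExt (∑ i, (p i : ℂ) • ρ i) (∑ i, (p i : ℂ) • σ i) := by
  refine ⟨posSemidef_sum _ fun i _ => (h i).1.smul (by exact_mod_cast hp i), ?_, ?_, ?_⟩
  · simp only [Matrix.trace_sum, Matrix.trace_smul, (h _).2.1, smul_eq_mul, mul_one]
    exact_mod_cast hsum
  · intro a a' b b'
    have := traceThird_sum_smul (fun i => (p i : ℂ)) σ
    simp only [(h _).traceThird_eq] at this
    exact congr($this (a, b) (a', b'))
  · intro a b₁ b₂ a' b₁' b₂'
    simp only [Matrix.sum_apply, Matrix.smul_apply]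
    exact Finset.sum_congr rfl fun i _ => by rw [(h i).2.2.2]

/-- The normalized pure state along a vector that is symmetric or antisymmetric under the swap is a
symmetric extension of its own partial trace. -/
theorem isSymExt_traceThird_pure {w : A × B × B → ℂ} (hw : w ≠ 0) {ε : ℂ}
    (hε : ε * star ε = 1) (hswap : ∀ a b c, w (a, c, b) = ε * w (a, b, c)) :
    IsSymExt (traceThird ((sqNorm w : ℂ)⁻¹ • vecMulVec w (star w)))
      ((sqNorm w : ℂ)⁻¹ • vecMulVec w (star w)) := by
  have hne : (sqNorm w : ℂ) ≠ 0 := by exact_mod_cast (sqNorm_pos hw).ne'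
  refine ⟨(posSemidef_vecMulVec_self_star w).smul ?_, ?_, fun _ _ _ _ => rfl, ?_⟩
  · exact_mod_cast inv_nonneg.mpr (sqNorm_nonneg w)
  · rw [Matrix.trace_smul, trace_vecMulVec_self_star, smul_eq_mul, inv_mul_cancel₀ hne]
  · intro a b₁ b₂ a' b₁' b₂'
    simp only [Matrix.smul_apply, vecMulVec_apply, Pi.star_apply, smul_eq_mul]
    rw [hswap a b₁ b₂, hswap a' b₁' b₂', star_mul']
    linear_combination (-(sqNorm w : ℂ)⁻¹ * w (a, b₁, b₂) * star (w (a', b₁', b₂'))) * hε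

theorem pureExt_traceThird_pure {w : A × B × B → ℂ} (hw : w ≠ 0) {ε : ℂ}
    (hε : ε * star ε = 1) (hswap : ∀ a b c, w (a, c, b) = ε * w (a, b, c)) :
    PureExt (traceThird ((sqNorm w : ℂ)⁻¹ • vecMulVec w (star w))) := by
  refine ⟨_, isSymExt_traceThird_pure hw hε hswap, ?_⟩
  rw [← smul_vecMulVec]
  have hne : (sqNorm w : ℂ) ≠ 0 := by exact_mod_cast (sqNorm_pos hw).ne'
  exact rank_vecMulVec_eq_one (smul_ne_zero (inv_ne_zero hne) hw) (star_ne_zero.mpr hw)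

/-- The partial trace of a swap-invariant state is a convex combination of pure-extendible states. -/
theorem IsSymExt.exists_convex_combination {ρ : Matrix (A × B) (A × B) ℂ}
    {σ : Matrix (A × B × B) (A × B × B) ℂ} (h : IsSymExt ρ σ) :
    ∃ (n : ℕ) (p : Fin n → ℝ) (ρs : Fin n → Matrix (A × B) (A × B) ℂ),
      (∀ j, 0 ≤ p j ∧ p j ≤ 1) ∧ (∑ j, p j = 1) ∧
      (∀ j, (ρs j).PosSemidef ∧ (ρs j).trace = 1 ∧ PureExt (ρs j)) ∧
      ρ = ∑ j, (p j : ℂ) • ρs j := by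
  classical
  obtain ⟨m, w, ε, hε, hswap, hσ⟩ := exists_sum_vecMulVec_of_swap_invariant h.1 h.2.2.2
  let e := (Fintype.equivFin {k // w k ≠ 0}).symm
  let u j := w (e j).1
  have hu : ∀ j, u j ≠ 0 := fun j => (e j).2
  have hσu : σ = ∑ j, vecMulVec (u j) (star (u j)) := by
    rw [hσ, e.sum_comp (fun k => vecMulVec (w k.1) (star (w k.1)))]
    rw [← Finset.sum_subtype {k | w k ≠ 0} (by simp) (fun k => vecMulVec (w k) (star (w k)))]
    refine (Finset.sum_filter_of_ne fun k _ hk => ?_).symm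
    intro h0
    simp [h0] at hk
  have hsum : ∑ j, sqNorm (u j) = 1 := by
    have := h.2.1
    rw [hσu, Matrix.trace_sum] at this
    simp only [trace_vecMulVec_self_star] at this
    exact_mod_cast this
  have hext j := isSymExt_traceThird_pure (hu j) (hε _) (hswap (e j).1)
  refine ⟨_, fun j => sqNorm (u j),
    fun j => traceThird ((sqNorm (u j) : ℂ)⁻¹ • vecMulVec (u j) (star (u j))),
    fun j => ⟨sqNorm_nonneg _, ?_⟩, hsum, fun j => ⟨(hext j).1.traceThird, ?_,
      pureExt_traceThird_pure (hu j) (hε _) (hswap (e j).1)⟩, ?_⟩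
  · rw [← hsum]
    exact Finset.single_le_sum (f := fun j => sqNorm (u j)) (fun _ _ => sqNorm_nonneg _)
      (Finset.mem_univ j)
  · rw [trace_traceThird]
    exact (hext j).2.1
  · rw [← traceThird_sum_smul, ← h.traceThird_eq, hσu]
    congr 1
    refine Finset.sum_congr rfl fun j _ => (smul_inv_smul₀ ?_ _).symm
    exact_mod_cast (sqNorm_pos (hu j)).ne'

end SymmetricExtension

/-- A bipartite state has a symmetric extension iff it is a convex combination of
pure-extendible states. -/
theorem stmt_2 (dA dB : ℕ)
    (ρ : Matrix (Fin dA × Fin dB) (Fin dA × Fin dB) ℂ)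
    (hρ : ρ.PosSemidef) (hρtr : ρ.trace = 1) :
    (∃ σ, IsSymExt ρ σ) ↔
    ∃ (n : ℕ) (p : Fin n → ℝ) (ρs : Fin n → Matrix (Fin dA × Fin dB) (Fin dA × Fin dB) ℂ),
      (∀ j, 0 ≤ p j ∧ p j ≤ 1) ∧ (∑ j, p j = 1) ∧
      (∀ j, (ρs j).PosSemidef ∧ (ρs j).trace = 1 ∧ PureExt (ρs j)) ∧
      ρ = ∑ j, (p j : ℂ) • ρs j := by
  constructor
  · rintro ⟨σ, hσ⟩
    exact hσ.exists_convex_combination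
  · rintro ⟨n, p, ρs, hp, hsum, hρs, rfl⟩
    choose σ hσ _ using fun j => (hρs j).2.2
    exact ⟨_, IsSymExt.sum_smul (fun j => (hp j).1) hsum hσ⟩
end
end

section
/- Let ρ be a bipartite state on A⊗B (dimensions dA, dB) that admits a symmetric extension of rank one, and let M be any dA×dA complex matrix. Then the (generally unnormalized) positive semidefinite matrix ρ̃ = (M ⊗ I_B) ρ (M ⊗ I_B)ᴴ satisfies the spectrum condition: the multiset of nonzero eigenvalues of ρ̃, counted with multiplicity, equals the multiset of nonzero eigenvalues of its reduction ρ̃_B, where ρ̃_B b b' = ∑_a ρ̃ (a,b) (a,b'). -/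
open Matrix Kronecker ComplexOrder

noncomputable section

/-- A matrix of rank one is an outer product of two vectors. -/
lemma exists_eq_vecMulVec_of_rank_eq_one {K m n : Type*} [Field K] [Fintype n] [DecidableEq n]
    {S : Matrix m n K} (hS : S.rank = 1) : ∃ (u : m → K) (v : n → K), S = vecMulVec u v := by
  obtain ⟨u, -, hu⟩ := finrank_eq_one_iff'.mp hS
  choose v hv using fun j : n => hu ⟨S.mulVecLin (Pi.single j 1), LinearMap.mem_range_self _ _⟩
  refine ⟨u, v, ?_⟩
  ext i j
  have h := congrFun (congrArg Subtype.val (hv j)) i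
  simp only [SetLike.val_smul, Pi.smul_apply, smul_eq_mul, mulVecLin_apply, mulVec_single_one,
    col_apply] at h
  rw [vecMulVec_apply, ← h, mul_comm]

/-- The two products of a pair of rectangular matrices have the same nonzero spectrum. -/
lemma nonzeroSpec_mul_comm {m n : Type*} [Fintype m] [DecidableEq m] [Fintype n] [DecidableEq n]
    (S : Matrix m n ℂ) (T : Matrix n m ℂ) : nonzeroSpec (S * T) = nonzeroSpec (T * S) := by
  have filter_roots (k : ℕ) {p : Polynomial ℂ} (hp : p.Monic) :
      (Polynomial.X ^ k * p).roots.filter (· ≠ 0) = p.roots.filter (· ≠ 0) := by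
    rw [Polynomial.roots_mul ((Polynomial.monic_X_pow k).mul hp).ne_zero, Polynomial.roots_X_pow,
      Multiset.filter_add, Multiset.filter_nsmul]
    simp
  unfold nonzeroSpec
  rw [← filter_roots (Fintype.card n) (charpoly_monic _), charpoly_mul_comm',
    filter_roots _ (charpoly_monic _)]

lemma nonzeroSpec_transpose {n : Type*} [Fintype n] [DecidableEq n] (S : Matrix n n ℂ) :
    nonzeroSpec Sᵀ = nonzeroSpec S := by
  rw [nonzeroSpec, nonzeroSpec, charpoly_transpose]

/-- The spectrum condition holds for a product `S * T` whose factors, read as vectors on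
`A ⊗ B ⊗ B`, have an outer product invariant under swapping the two `B` factors. -/
lemma nonzeroSpec_mul_eq_nonzeroSpec_reduceB {A B : Type*} [Fintype A] [DecidableEq A]
    [Fintype B] [DecidableEq B] (S : Matrix (A × B) B ℂ) (T : Matrix B (A × B) ℂ)
    (h : ∀ a b₁ b₂ a' b₁' b₂',
      S (a, b₁) b₂ * T b₂' (a', b₁') = S (a, b₂) b₁ * T b₁' (a', b₂')) :
    nonzeroSpec (S * T) = nonzeroSpec (reduceB (S * T)) := by
  have reduceB_eq : reduceB (S * T) = (T * S)ᵀ := by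
    ext b b'
    simp only [reduceB, mul_apply, transpose_apply, Fintype.sum_prod_type]
    refine Finset.sum_congr rfl fun a _ => Finset.sum_congr rfl fun c _ => ?_
    rw [h, mul_comm]
  rw [reduceB_eq, nonzeroSpec_transpose, nonzeroSpec_mul_comm]

/-- Local filtering on `A` preserves the spectrum condition for pure-extendible states. -/
theorem stmt_4 (dA dB : ℕ)
    (ρ : Matrix (Fin dA × Fin dB) (Fin dA × Fin dB) ℂ)
    (hρ : ρ.PosSemidef) (hρtr : ρ.trace = 1)
    (hpure : PureExt ρ)
    (M : Matrix (Fin dA) (Fin dA) ℂ)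
    (ρtilde : Matrix (Fin dA × Fin dB) (Fin dA × Fin dB) ℂ)
    (hρtilde : ρtilde = (M ⊗ₖ (1 : Matrix (Fin dB) (Fin dB) ℂ)) * ρ *
      (M ⊗ₖ (1 : Matrix (Fin dB) (Fin dB) ℂ))ᴴ) :
    nonzeroSpec ρtilde = nonzeroSpec (reduceB ρtilde) := by
  obtain ⟨σ, ⟨-, -, hσρ, hσ⟩, hrank⟩ := hpure
  obtain ⟨u, v, rfl⟩ := exists_eq_vecMulVec_of_rank_eq_one hrank
  simp only [vecMulVec_apply] at hσρ hσ
  let U : Matrix (Fin dA × Fin dB) (Fin dB) ℂ := of fun p c => u (p.1, p.2, c)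
  let V : Matrix (Fin dB) (Fin dA × Fin dB) ℂ := of fun c p => v (p.1, p.2, c)
  have hUV : ρ = U * V := by
    ext ⟨a, b⟩ ⟨a', b'⟩
    simp [U, V, mul_apply, hσρ]
  have hU (a b c) : ((M ⊗ₖ (1 : Matrix (Fin dB) (Fin dB) ℂ)) * U) (a, b) c
      = ∑ x, M a x * u (x, b, c) := by
    simp [U, mul_apply, Fintype.sum_prod_type, one_apply]
  have hV (a b c) : (V * (M ⊗ₖ (1 : Matrix (Fin dB) (Fin dB) ℂ))ᴴ) c (a, b)
      = ∑ y, v (y, b, c) * star (M a y) := by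
    simp [V, mul_apply, Fintype.sum_prod_type, one_apply, apply_ite]
  rw [hρtilde, hUV, ← Matrix.mul_assoc, Matrix.mul_assoc]
  refine nonzeroSpec_mul_eq_nonzeroSpec_reduceB _ _ fun a b₁ b₂ a' b₁' b₂' => ?_
  simp only [hU, hV, Finset.sum_mul_sum]
  refine Finset.sum_congr rfl fun x _ => Finset.sum_congr rfl fun y _ => ?_
  linear_combination M a x * star (M a' y) * hσ x b₁ b₂ y b₁' b₂'
end
end

section
/- Let ρ be a two-qubit state (positive semidefinite trace-1 matrix indexed by Fin 2 × Fin 2) which is mixed (rank at least 2) and pure-extendible. Then the following are equivalent: (1) ρ can be written as a finite convex combination ρ = ∑_j p_j ρ_j with all p_j > 0, ∑_j p_j = 1, every ρ_j pure-extendible, and at least one ρ_j ≠ ρ; (2) ρ is separable, i.e., ρ is a finite convex combination of rank-one product states (ψ_j ⊗ φ_j)(ψ_j ⊗ φ_j)ᴴ with unit vectors ψ_j, φ_j ∈ ℂ²; (3) there exist unit vectors ψ₀, ψ₁ ∈ ℂ², orthonormal vectors e₀, e₁ ∈ ℂ², and 0 < λ < 1 such that ρ = λ (ψ₀⊗e₀)(ψ₀⊗e₀)ᴴ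 + (1−λ) (ψ₁⊗e₁)(ψ₁⊗e₁)ᴴ. -/
open Matrix Kronecker ComplexOrder

noncomputable section

/-- The polarized difference of the purities of a bipartite matrix and of its marginal on the
second factor. -/
def purityGap {A B : Type*} [Fintype A] [Fintype B] (X Y : Matrix (A × B) (A × B) ℂ) : ℂ :=
  (X * Y).trace - (reduceB X * reduceB Y).trace

section PurityGap

lemma reduceB_sub {A B : Type*} [Fintype A] (X Y : Matrix (A × B) (A × B) ℂ) :
    reduceB (X - Y) = reduceB X - reduceB Y := by
  ext; simp [reduceB]

lemma reduceB_sum_smul {A B ι : Type*} [Fintype A] (s : Finset ι) (c : ι → ℂ)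
    (X : ι → Matrix (A × B) (A × B) ℂ) :
    reduceB (∑ j ∈ s, c j • X j) = ∑ j ∈ s, c j • reduceB (X j) := by
  ext b b'
  simp only [reduceB, Matrix.sum_apply, Matrix.smul_apply, Finset.smul_sum]
  exact Finset.sum_comm

variable {A B : Type*} [Fintype A] [Fintype B]

lemma purityGap_comm (X Y : Matrix (A × B) (A × B) ℂ) : purityGap X Y = purityGap Y X := by
  simp only [purityGap, Matrix.trace_mul_comm X, Matrix.trace_mul_comm (reduceB X)]

lemma purityGap_sub_self (X Y : Matrix (A × B) (A × B) ℂ) :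
    purityGap (X - Y) (X - Y) = purityGap X X - 2 * purityGap X Y + purityGap Y Y := by
  have h := purityGap_comm X Y
  simp only [purityGap, reduceB_sub, sub_mul, mul_sub, Matrix.trace_sub] at h ⊢
  linear_combination h

lemma purityGap_sum_smul_left {ι : Type*} (s : Finset ι) (c : ι → ℂ)
    (X : ι → Matrix (A × B) (A × B) ℂ) (Y : Matrix (A × B) (A × B) ℂ) :
    purityGap (∑ j ∈ s, c j • X j) Y = ∑ j ∈ s, c j * purityGap (X j) Y := by
  simp [purityGap, reduceB_sum_smul, Finset.sum_mul, Matrix.trace_sum, mul_sub]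

lemma purityGap_smul_smul (c : ℂ) (X : Matrix (A × B) (A × B) ℂ) :
    purityGap (c • X) (c • X) = c ^ 2 * purityGap X X := by
  have h : reduceB (c • X) = c • reduceB X := by
    ext; simp [reduceB, Finset.mul_sum]
  simp only [purityGap, h, Matrix.smul_mul, Matrix.mul_smul, Matrix.trace_smul, smul_eq_mul]
  ring

/-- Variance identity for the purity gap of a convex combination. -/
lemma sum_mul_purityGap_sub {n : ℕ} (p : Fin n → ℝ) (hp : ∑ j, p j = 1)
    (X : Fin n → Matrix (A × B) (A × B) ℂ) (Y : Matrix (A × B) (A × B) ℂ)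
    (hY : Y = ∑ j, (p j : ℂ) • X j) :
    ∑ j, (p j : ℂ) * purityGap (X j - Y) (X j - Y) =
      ∑ j, (p j : ℂ) * purityGap (X j) (X j) - purityGap Y Y := by
  have h1 : purityGap Y Y = ∑ j, (p j : ℂ) * purityGap (X j) Y := by
    conv_lhs => rw [hY, purityGap_sum_smul_left, ← hY]
  have h2 : ∑ j, (p j : ℂ) = 1 := by exact_mod_cast hp
  simp only [purityGap_sub_self, mul_add, mul_sub, Finset.sum_add_distrib, Finset.sum_sub_distrib,
    ← Finset.sum_mul, h2, mul_left_comm _ (2 : ℂ), ← Finset.mul_sum, ← h1]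
  ring

end PurityGap

lemma exists_eq_vecMulVec_of_rank_eq_one_s7 {n : Type*} [Fintype n] [DecidableEq n]
    (M : Matrix n n ℂ) (h : M.rank = 1) : ∃ x y : n → ℂ, M = vecMulVec x y := by
  obtain ⟨⟨v, hv⟩, hspan⟩ := finrank_le_one_iff.mp (show Module.finrank ℂ M.mulVecLin.range ≤ 1
    from h.le)
  have hcol (j : n) : ∃ c : ℂ, c • v = M *ᵥ Pi.single j 1 := by
    obtain ⟨c, hc⟩ := hspan ⟨M.mulVecLin (Pi.single j 1), ⟨_, rfl⟩⟩
    exact ⟨c, by simpa using congrArg Subtype.val hc⟩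
  choose c hc using hcol
  refine ⟨v, c, ?_⟩
  ext i j
  have := congrFun (hc j) i
  simp only [Pi.smul_apply, smul_eq_mul, mulVec_single_one, col_apply] at this
  rw [← this, vecMulVec_apply, mul_comm]

lemma PureExt.purityGap_self {A B : Type*} [Fintype A] [DecidableEq A] [Fintype B] [DecidableEq B]
    {ρ : Matrix (A × B) (A × B) ℂ} (h : PureExt ρ) : purityGap ρ ρ = 0 := by
  obtain ⟨σ, ⟨-, -, hpt, hswap⟩, hrank⟩ := h
  obtain ⟨x, y, rfl⟩ := exists_eq_vecMulVec_of_rank_eq_one_s7 σ hrank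
  simp only [vecMulVec_apply] at hpt hswap
  rw [purityGap, sub_eq_zero]
  simp only [Matrix.trace, Matrix.diag, Matrix.mul_apply, reduceB, Fintype.sum_prod_type, ← hpt,
    Finset.sum_mul_sum]
  have hl : ∑ a, ∑ b, ∑ a', ∑ b', ∑ c, ∑ c',
      (x (a, b, c) * y (a', b', c)) * (x (a', b', c') * y (a, b, c')) =
      ∑ a, ∑ b, ∑ a', ∑ b', ∑ c, ∑ c',
      (x (a, c, b) * y (a, c', b)) * (x (a', c', b') * y (a', c, b')) := by
    refine Finset.sum_congr rfl fun a _ => Finset.sum_congr rfl fun b _ =>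
      Finset.sum_congr rfl fun a' _ => Finset.sum_congr rfl fun b' _ =>
      Finset.sum_congr rfl fun c _ => Finset.sum_congr rfl fun c' _ => ?_
    rw [← hswap a b c a b c', ← hswap a' b' c' a' b' c]
    ring
  have hr (F : A → B → A → B → B → B → ℂ) : ∑ a, ∑ b, ∑ a', ∑ b', ∑ c, ∑ c', F a b a' b' c c' =
      ∑ c, ∑ c', ∑ a, ∑ a', ∑ b, ∑ b', F a b a' b' c c' := by
    let e : A × B × A × B × B × B ≃ B × B × A × A × B × B :=
      ⟨fun t => (t.2.2.2.2.1, t.2.2.2.2.2, t.1, t.2.2.1, t.2.1, t.2.2.2.1),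
        fun t => (t.2.2.1, t.2.2.2.2.1, t.2.2.2.1, t.2.2.2.2.2, t.1, t.2.1),
        fun _ => rfl, fun _ => rfl⟩
    have := Fintype.sum_equiv e
      (fun t => F t.1 t.2.1 t.2.2.1 t.2.2.2.1 t.2.2.2.2.1 t.2.2.2.2.2)
      (fun t => F t.2.2.1 t.2.2.2.2.1 t.2.2.2.1 t.2.2.2.2.2 t.1 t.2.1) fun _ => rfl
    simpa only [Fintype.sum_prod_type] using this
  rw [hl, hr]

lemma PureExt.rank_le {A B : Type*} [Fintype A] [DecidableEq A] [Fintype B] [DecidableEq B]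
    {ρ : Matrix (A × B) (A × B) ℂ} (h : PureExt ρ) : ρ.rank ≤ Fintype.card B := by
  obtain ⟨σ, ⟨-, -, hpt, -⟩, hrank⟩ := h
  obtain ⟨x, y, rfl⟩ := exists_eq_vecMulVec_of_rank_eq_one_s7 σ hrank
  have : ρ = (Matrix.of fun (q : A × B) (c : B) => x (q.1, q.2, c)) *
      (Matrix.of fun (c : B) (q : A × B) => y (q.1, q.2, c)) := by
    ext ⟨a, b⟩ ⟨a', b'⟩
    simp [← hpt, Matrix.mul_apply, vecMulVec_apply]
  rw [this]
  exact (Matrix.rank_mul_le_left _ _).trans (Matrix.rank_le_card_width _)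

/-- A pure product state has the pure symmetric extension `ψ ⊗ φ ⊗ φ`. -/
lemma pureExt_product {A B : Type*} [Fintype A] [DecidableEq A] [Fintype B] [DecidableEq B]
    (ψ : A → ℂ) (φ : B → ℂ) (hψ : star ψ ⬝ᵥ ψ = 1) (hφ : star φ ⬝ᵥ φ = 1) :
    PureExt (vecMulVec (fun x : A × B => ψ x.1 * φ x.2)
      (star fun x : A × B => ψ x.1 * φ x.2)) := by
  have hψ' : ∑ a, ψ a * star (ψ a) = 1 := by simpa [dotProduct, mul_comm] using hψ
  have hφ' : ∑ a, φ a * star (φ a) = 1 := by simpa [dotProduct, mul_comm] using hφ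
  set w : A × B × B → ℂ := fun x => ψ x.1 * φ x.2.1 * φ x.2.2 with hw
  have htr : (vecMulVec w (star w)).trace = 1 := by
    have : (vecMulVec w (star w)).trace =
        (∑ a, ψ a * star (ψ a)) * ((∑ b, φ b * star (φ b)) * (∑ b, φ b * star (φ b))) := by
      simp only [Matrix.trace, Matrix.diag, vecMulVec_apply, Pi.star_apply, hw,
        Fintype.sum_prod_type, Finset.sum_mul_sum, star_mul']
      simp only [Finset.mul_sum]
      exact Finset.sum_congr rfl fun a _ => Finset.sum_congr rfl fun b _ =>
        Finset.sum_congr rfl fun c _ => by ring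
    rw [this, hψ', hφ']; simp
  refine ⟨vecMulVec w (star w), ⟨posSemidef_vecMulVec_self_star w, htr, ?_, ?_⟩, ?_⟩
  · intro a a' b b'
    have : ∀ c, vecMulVec w (star w) (a, b, c) (a', b', c) =
        (ψ a * φ b * (star (ψ a') * star (φ b'))) * (φ c * star (φ c)) := by
      intro c
      simp only [vecMulVec_apply, Pi.star_apply, hw, star_mul']
      ring
    simp only [this, ← Finset.mul_sum, hφ', mul_one]
    simp [vecMulVec_apply]
  · intro a b₁ b₂ a' b₁' b₂'
    simp only [vecMulVec_apply, Pi.star_apply, hw, star_mul']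
    ring
  · refine le_antisymm (Matrix.rank_vecMulVec_le _ _) ?_
    rw [Nat.one_le_iff_ne_zero]
    intro h0
    rw [Matrix.rank, Submodule.finrank_eq_zero, LinearMap.range_eq_bot] at h0
    have hzero : vecMulVec w (star w) = 0 := by
      ext i j
      simpa using congrFun (LinearMap.congr_fun h0 (Pi.single j 1)) i
    simp [hzero] at htr

/-- A Hermitian matrix of rank `r` is supported on the range of an isometry from dimension `r`. -/
lemma Matrix.IsHermitian.exists_isometry {n : Type*} [Fintype n] [DecidableEq n]
    {X : Matrix n n ℂ} (hX : X.IsHermitian) {r : ℕ} (hr : X.rank = r) :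
    ∃ V : Matrix n (Fin r) ℂ, Vᴴ * V = 1 ∧ X * (V * Vᴴ) = X := by
  have e : Fin r ≃ {i // hX.eigenvalues i ≠ 0} :=
    (Fintype.equivFinOfCardEq (hX.rank_eq_card_non_zero_eigs ▸ hr)).symm
  set U : Matrix n n ℂ := ↑hX.eigenvectorUnitary with hU
  have hUU : Uᴴ * U = 1 := Unitary.coe_star_mul_self hX.eigenvectorUnitary
  have hspec : X = U * diagonal (RCLike.ofReal ∘ hX.eigenvalues) * Uᴴ := hX.spectral_theorem
  have hinj : Function.Injective fun k : Fin r => (e k : n) :=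
    Subtype.val_injective.comp e.injective
  refine ⟨U.submatrix id fun k => (e k : n), ?_, ?_⟩
  · rw [conjTranspose_submatrix, ← Matrix.submatrix_mul _ _ _ _ _ Function.bijective_id, hUU]
    exact Matrix.submatrix_one _ hinj
  · have hXU : X * U = U * diagonal (RCLike.ofReal ∘ hX.eigenvalues) := by
      conv_lhs => rw [hspec, Matrix.mul_assoc, hUU, Matrix.mul_one]
    rw [← Matrix.mul_assoc]
    conv_rhs => rw [hspec]
    ext i j
    simp only [Matrix.mul_apply (N := Uᴴ), Matrix.mul_apply (N := (U.submatrix _ _)ᴴ)]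
    refine Fintype.sum_of_injective _ hinj _ _ (fun k hk => ?_) fun k => ?_
    · have : hX.eigenvalues k = 0 := by
        by_contra h0
        exact hk ⟨e.symm ⟨k, h0⟩, by simp⟩
      simp [this]
    · rw [← hXU]; rfl

/-- Diagonalization of a Hermitian matrix inside the range of an isometry supporting it. -/
lemma Matrix.IsHermitian.exists_diagonal_of_isometry {n k : Type*} [Fintype n] [DecidableEq n]
    [Fintype k] [DecidableEq k] {X : Matrix n n ℂ} (hX : X.IsHermitian)
    (V : Matrix n k ℂ) (hXV : X * (V * Vᴴ) = X) :
    ∃ (U : Matrix k k ℂ) (μ : k → ℝ), Uᴴ * U = 1 ∧ U * Uᴴ = 1 ∧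
      X = (V * U) * diagonal (fun i => (μ i : ℂ)) * (V * U)ᴴ := by
  have hD : (Vᴴ * X * V).IsHermitian := isHermitian_conjTranspose_mul_mul V hX
  obtain ⟨U, μ, hUU, hUU', hspec⟩ : ∃ (U : Matrix k k ℂ) (μ : k → ℝ), Uᴴ * U = 1 ∧ U * Uᴴ = 1 ∧
      Vᴴ * X * V = U * diagonal (fun i => (μ i : ℂ)) * Uᴴ :=
    ⟨hD.eigenvectorUnitary, hD.eigenvalues, Unitary.coe_star_mul_self hD.eigenvectorUnitary,
      Unitary.coe_mul_star_self hD.eigenvectorUnitary, hD.spectral_theorem⟩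
  refine ⟨U, μ, hUU, hUU', ?_⟩
  have hVX : V * Vᴴ * X = X := by
    have := congrArg (fun Y => Yᴴ) hXV
    simpa [conjTranspose_mul, hX.eq, Matrix.mul_assoc] using this
  calc X = V * (Vᴴ * X * V) * Vᴴ := by
        conv_lhs => rw [← hXV, ← hVX]
        simp only [Matrix.mul_assoc]
    _ = _ := by
        rw [hspec]
        simp only [conjTranspose_mul, Matrix.mul_assoc]

/-- Each component of a positive combination is supported where the whole is. -/
lemma mul_eq_self_of_sum {n ι : Type*} [Fintype n] [DecidableEq n] [Fintype ι] (p : ι → ℝ)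
    (X : ι → Matrix n n ℂ) (hp : ∀ j, 0 ≤ p j) (hX : ∀ j, (X j).PosSemidef)
    (P : Matrix n n ℂ) (hP : P.IsHermitian)
    (hsum : (∑ j, (p j : ℂ) • X j) * P = ∑ j, (p j : ℂ) • X j) (j : ι) (hj : 0 < p j) :
    X j * P = X j := by
  set Q := 1 - P with hQ
  have hQh : Qᴴ = Q := by simp [hQ, hP.eq]
  have h0 : ∑ j, (p j : ℂ) • (Qᴴ * X j * Q) = 0 := by
    have : (∑ j, (p j : ℂ) • X j) * Q = 0 := by rw [hQ, mul_sub, mul_one, hsum, sub_self]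
    have := congrArg (Qᴴ * ·) this
    simpa [Finset.sum_mul, Finset.mul_sum, Matrix.mul_assoc] using this
  have hpsd (i : ι) : (Qᴴ * X i * Q).PosSemidef := (hX i).conjTranspose_mul_mul_same Q
  have htr := congrArg Matrix.trace h0
  simp only [Matrix.trace_sum, Matrix.trace_smul, smul_eq_mul, Matrix.trace_zero] at htr
  have hnn : ∀ i ∈ Finset.univ, 0 ≤ (p i : ℂ) * (Qᴴ * X i * Q).trace := fun i _ =>
    mul_nonneg (by exact_mod_cast hp i) (hpsd i).trace_nonneg
  have hjtr := (Finset.sum_eq_zero_iff_of_nonneg hnn).mp htr j (Finset.mem_univ j)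
  have hpj : (p j : ℂ) ≠ 0 := by exact_mod_cast hj.ne'
  have hz : Qᴴ * X j * Q = 0 := (hpsd j).trace_eq_zero_iff.mp
    ((mul_eq_zero.mp hjtr).resolve_left hpj)
  have : X j * Q = 0 := by
    ext a b
    have hb : star (Q.col b) ⬝ᵥ (X j *ᵥ Q.col b) = 0 := by
      have := congrFun (congrFun hz b) b
      rw [Matrix.mul_assoc, Matrix.mul_apply] at this
      exact this
    exact congrFun (((hX j).dotProduct_mulVec_zero_iff _).mp hb) a
  rw [hQ, mul_sub, mul_one, sub_eq_zero] at this
  exact this.symm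

/-- The matrix whose columns are the product vectors `x k ⊗ e k`. -/
def productColumns {A B k : Type*} (x : k → A → ℂ) (e : k → B → ℂ) : Matrix (A × B) k ℂ :=
  Matrix.of fun q i => x i q.1 * e i q.2

lemma conjTranspose_productColumns_mul_self {A B k : Type*} [Fintype A] [Fintype B]
    (x : k → A → ℂ) (e : k → B → ℂ) (i j : k) :
    ((productColumns x e)ᴴ * productColumns x e) i j =
      (star (x i) ⬝ᵥ x j) * (star (e i) ⬝ᵥ e j) := by
  simp only [Matrix.mul_apply, conjTranspose_apply, productColumns, of_apply, dotProduct,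
    Fintype.sum_prod_type, Finset.sum_mul_sum, Pi.star_apply, star_mul']
  exact Finset.sum_congr rfl fun a _ => Finset.sum_congr rfl fun b _ => by ring

lemma productColumns_isometry {A B : Type*} [Fintype A] [Fintype B]
    {x : Fin 2 → A → ℂ} {e : Fin 2 → B → ℂ} (hx : ∀ k, star (x k) ⬝ᵥ x k = 1)
    (he : ∀ k, star (e k) ⬝ᵥ e k = 1) (horth : star (e 0) ⬝ᵥ e 1 = 0) :
    (productColumns x e)ᴴ * productColumns x e = 1 := by
  have horth' : star (e 1) ⬝ᵥ e 0 = 0 := by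
    rw [star_dotProduct, horth, star_zero]
  ext i j
  rw [conjTranspose_productColumns_mul_self]
  fin_cases i <;> fin_cases j
  · simpa using by rw [hx, he, one_mul]
  · simp [horth]
  · simp [horth']
  · simpa using by rw [hx, he, one_mul]

lemma trace_sq_of_isometry {m k : Type*} [Fintype m] [Fintype k] [DecidableEq k]
    {Y : Matrix m k ℂ} (hY : Yᴴ * Y = 1) (S : Matrix k k ℂ) :
    (Y * S * Yᴴ * (Y * S * Yᴴ)).trace = (S * S).trace := by
  have : Y * S * Yᴴ * (Y * S * Yᴴ) = Y * (S * (Yᴴ * Y) * S * Yᴴ) := by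
    simp only [Matrix.mul_assoc]
  rw [this, hY, Matrix.mul_one, Matrix.trace_mul_comm, Matrix.mul_assoc, hY, Matrix.mul_one]

/-- The purity gap of a matrix supported on two product vectors with orthonormal second factors. -/
lemma purityGap_productColumns {A B : Type*} [Fintype A] [Fintype B]
    {x : Fin 2 → A → ℂ} {e : Fin 2 → B → ℂ} (hx : ∀ k, star (x k) ⬝ᵥ x k = 1)
    (he : ∀ k, star (e k) ⬝ᵥ e k = 1) (horth : star (e 0) ⬝ᵥ e 1 = 0)
    (R : Matrix (Fin 2) (Fin 2) ℂ) :
    purityGap (productColumns x e * R * (productColumns x e)ᴴ)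
      (productColumns x e * R * (productColumns x e)ᴴ) =
    2 * (R 0 1 * R 1 0) * (1 - (star (x 0) ⬝ᵥ x 1) * (star (x 1) ⬝ᵥ x 0)) := by
  set E : Matrix B (Fin 2) ℂ := Matrix.of fun b k => e k b with hE
  have hEE : Eᴴ * E = 1 := by
    have horth' : star (e 1) ⬝ᵥ e 0 = 0 := by
      rw [star_dotProduct, horth, star_zero]
    ext i j
    have : (Eᴴ * E) i j = star (e i) ⬝ᵥ e j := rfl
    rw [this]
    fin_cases i <;> fin_cases j <;> simp [horth, horth'] <;> exact he _
  have hred : reduceB (productColumns x e * R * (productColumns x e)ᴴ) =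
      E * (Matrix.of fun k l => R k l * (star (x l) ⬝ᵥ x k)) * Eᴴ := by
    ext b b'
    simp only [reduceB, Matrix.mul_apply, Fin.sum_univ_two, productColumns, hE, of_apply,
      conjTranspose_apply, dotProduct, Pi.star_apply, star_mul', Finset.mul_sum, Finset.sum_mul,
      ← Finset.sum_add_distrib]
    exact Finset.sum_congr rfl fun a _ => by ring
  rw [purityGap, hred, trace_sq_of_isometry (productColumns_isometry hx he horth),
    trace_sq_of_isometry hEE]
  simp only [Matrix.trace, Matrix.diag, Matrix.mul_apply, Fin.sum_univ_two, of_apply, hx]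
  ring

/-- The purity gap of a difference of two pure two-qubit states. -/
lemma purityGap_sub_vecMulVec (u v : Fin 2 × Fin 2 → ℂ) :
    purityGap (vecMulVec u (star u) - vecMulVec v (star v))
      (vecMulVec u (star u) - vecMulVec v (star v)) =
    2 * (Complex.normSq (u (0, 0) * u (1, 1) - u (0, 1) * u (1, 0)) +
      Complex.normSq (v (0, 0) * v (1, 1) - v (0, 1) * v (1, 0)) +
      ∑ a, ∑ a', Complex.normSq (∑ b, star (u (a, b)) * v (a', b)) -
      Complex.normSq (star u ⬝ᵥ v) : ℝ) := by
  simp only [Complex.ofReal_add, Complex.ofReal_sub, Complex.normSq_eq_conj_mul_self, purityGap,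
    reduceB, Matrix.trace, Matrix.diag, Matrix.mul_apply, Fintype.sum_prod_type, Fin.sum_univ_two,
    vecMulVec_apply, Matrix.sub_apply, Pi.star_apply, dotProduct, map_sub, map_add, map_mul,
    RCLike.star_def, Complex.conj_conj]
  ring

lemma mul_diagonal_mul_conjTranspose_fin_two {n : Type*} (W : Matrix n (Fin 2) ℂ)
    (μ : Fin 2 → ℂ) :
    W * diagonal μ * Wᴴ = μ 0 • vecMulVec (W.col 0) (star (W.col 0)) +
      μ 1 • vecMulVec (W.col 1) (star (W.col 1)) := by
  ext i j
  simp [Matrix.mul_apply, vecMulVec_apply, Matrix.diagonal_apply]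
  ring

lemma exists_smul_sub_of_trace_eq_zero {n : Type*} [Fintype n] [DecidableEq n]
    {X : Matrix n n ℂ} (hX : X.IsHermitian) (htr : X.trace = 0)
    (V : Matrix n (Fin 2) ℂ) (hV : Vᴴ * V = 1) (hXV : X * (V * Vᴴ) = X) :
    ∃ (W : Matrix n (Fin 2) ℂ) (δ : ℝ), Wᴴ * W = 1 ∧ W * Wᴴ = V * Vᴴ ∧
      X = (δ : ℂ) • (vecMulVec (W.col 0) (star (W.col 0)) -
        vecMulVec (W.col 1) (star (W.col 1))) := by
  obtain ⟨U, μ, hU, hU', h⟩ := hX.exists_diagonal_of_isometry V hXV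
  have hW : (V * U)ᴴ * (V * U) = 1 := by
    rw [conjTranspose_mul, Matrix.mul_assoc, ← Matrix.mul_assoc Vᴴ, hV, Matrix.one_mul, hU]
  have hμ : (μ 0 : ℂ) + μ 1 = 0 := by
    rw [h, Matrix.trace_mul_comm, ← Matrix.mul_assoc, hW, Matrix.one_mul] at htr
    simpa using htr
  refine ⟨V * U, μ 0, hW, ?_, ?_⟩
  · rw [conjTranspose_mul, Matrix.mul_assoc, ← Matrix.mul_assoc U, hU', Matrix.one_mul]
  · conv_lhs => rw [h]
    rw [mul_diagonal_mul_conjTranspose_fin_two, eq_neg_of_add_eq_zero_right hμ, smul_sub, neg_smul,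
      sub_eq_add_neg]

lemma exists_product_of_det_eq_zero (u : Fin 2 × Fin 2 → ℂ)
    (hdet : u (0, 0) * u (1, 1) - u (0, 1) * u (1, 0) = 0) (hu : star u ⬝ᵥ u = 1) :
    ∃ x e : Fin 2 → ℂ, star x ⬝ᵥ x = 1 ∧ star e ⬝ᵥ e = 1 ∧ u = fun q => x q.1 * e q.2 := by
  have hrow : ∃ a₀, (fun b => u (a₀, b)) ≠ 0 := by
    by_contra! h
    have : u = 0 := by ext ⟨a, b⟩; exact congrFun (h a) b
    simp [this] at hu
  obtain ⟨a₀, ha₀⟩ := hrow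
  have hminor (a b b') : u (a, b') * u (a₀, b) = u (a, b) * u (a₀, b') := by
    fin_cases a <;> fin_cases b <;> fin_cases b' <;> fin_cases a₀ <;> grind
  set N : ℝ := ∑ b, Complex.normSq (u (a₀, b)) with hN
  have hNpos : 0 < N := by
    obtain ⟨b, hb⟩ := Function.ne_iff.mp ha₀
    exact Finset.sum_pos' (fun _ _ => Complex.normSq_nonneg _)
      ⟨b, Finset.mem_univ b, Complex.normSq_pos.mpr hb⟩
  have hNC : (N : ℂ) = ∑ b, star (u (a₀, b)) * u (a₀, b) := by
    simp [hN, Complex.normSq_eq_conj_mul_self]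
  have hsq : ((√N : ℝ) : ℂ) * (√N : ℝ) = N := by
    rw [← Complex.ofReal_mul, Real.mul_self_sqrt hNpos.le]
  have hs0 : ((√N : ℝ) : ℂ) ≠ 0 := by
    exact_mod_cast (Real.sqrt_pos.mpr hNpos).ne'
  have hN0 : (N : ℂ) ≠ 0 := by exact_mod_cast hNpos.ne'
  set e : Fin 2 → ℂ := fun b => u (a₀, b) / (√N : ℝ) with he
  set x : Fin 2 → ℂ := fun a => ∑ b, u (a, b) * star (e b) with hx
  have hee : star e ⬝ᵥ e = 1 := by
    have : star e ⬝ᵥ e = (∑ b, star (u (a₀, b)) * u (a₀, b)) / ((√N : ℝ) * (√N : ℝ)) := by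
      simp only [dotProduct, he, Pi.star_apply, star_div₀, Finset.sum_div, RCLike.star_def,
        Complex.conj_ofReal, div_mul_div_comm]
    rw [this, hsq, ← hNC, div_self hN0]
  have hux (q : Fin 2 × Fin 2) : u q = x q.1 * e q.2 := by
    obtain ⟨a, b⟩ := q
    have h1 : x a * e b = ∑ b', u (a, b) * (star (e b') * e b') := by
      simp only [hx, Finset.sum_mul]
      refine Finset.sum_congr rfl fun b' _ => ?_
      have := hminor a b b'
      simp only [he]
      linear_combination (star (u (a₀, b') / ((√N : ℝ) : ℂ)) / ((√N : ℝ) : ℂ)) * this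
    have h2 : ∑ b', star (e b') * e b' = 1 := hee
    rw [h1, ← Finset.mul_sum, h2, mul_one]
  refine ⟨x, e, ?_, hee, funext hux⟩
  have : star u ⬝ᵥ u = (star x ⬝ᵥ x) * (star e ⬝ᵥ e) := by
    simp only [dotProduct, Pi.star_apply, Fintype.sum_prod_type, Finset.sum_mul_sum, hux, star_mul']
    exact Finset.sum_congr rfl fun a _ => Finset.sum_congr rfl fun b _ => by ring
  rw [hu, hee, mul_one] at this
  exact this.symm

lemma conjTranspose_mul_self_col {n k : Type*} [Fintype n] (W : Matrix n k ℂ) (i j : k) :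
    star (W.col i) ⬝ᵥ W.col j = (Wᴴ * W) i j := rfl

/-- On traceless Hermitian matrices supported on a two-dimensional subspace of two qubits, the
purity gap is nonnegative, and if it vanishes at a nonzero matrix then the subspace is spanned by
two product vectors with orthonormal second factors. -/
lemma purityGap_nonneg_of_trace_eq_zero {X : Matrix (Fin 2 × Fin 2) (Fin 2 × Fin 2) ℂ}
    (hX : X.IsHermitian) (htr : X.trace = 0) (V : Matrix (Fin 2 × Fin 2) (Fin 2) ℂ)
    (hV : Vᴴ * V = 1) (hXV : X * (V * Vᴴ) = X) :
    0 ≤ purityGap X X ∧ (purityGap X X = 0 → X ≠ 0 →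
      ∃ x e : Fin 2 → Fin 2 → ℂ, (∀ k, star (x k) ⬝ᵥ x k = 1) ∧ (∀ k, star (e k) ⬝ᵥ e k = 1) ∧
        star (e 0) ⬝ᵥ e 1 = 0 ∧
        productColumns x e * (productColumns x e)ᴴ = V * Vᴴ) := by
  obtain ⟨W, δ, hW, hWV, rfl⟩ := exists_smul_sub_of_trace_eq_zero hX htr V hV hXV
  have horth : star (W.col 0) ⬝ᵥ W.col 1 = 0 := by simp [conjTranspose_mul_self_col, hW]
  have hnorm (k) : star (W.col k) ⬝ᵥ W.col k = 1 := by simp [conjTranspose_mul_self_col, hW]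
  rw [purityGap_smul_smul, purityGap_sub_vecMulVec, horth, map_zero, sub_zero]
  set d₀ := Complex.normSq (W.col 0 (0, 0) * W.col 0 (1, 1) - W.col 0 (0, 1) * W.col 0 (1, 0))
    with hd₀
  set d₁ := Complex.normSq (W.col 1 (0, 0) * W.col 1 (1, 1) - W.col 1 (0, 1) * W.col 1 (1, 0))
    with hd₁
  set t := ∑ a, ∑ a', Complex.normSq (∑ b, star (W.col 0 (a, b)) * W.col 1 (a', b)) with ht
  have h0 : 0 ≤ d₀ := Complex.normSq_nonneg _
  have h1 : 0 ≤ d₁ := Complex.normSq_nonneg _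
  have h2 : 0 ≤ t :=
    Finset.sum_nonneg fun _ _ => Finset.sum_nonneg fun _ _ => Complex.normSq_nonneg _
  refine ⟨?_, fun hz hne => ?_⟩
  · have : 0 ≤ δ ^ 2 * (2 * (d₀ + d₁ + t)) := by positivity
    exact_mod_cast this
  have hδ : δ ≠ 0 := by rintro rfl; simp at hne
  have hz' : δ ^ 2 * (2 * (d₀ + d₁ + t)) = 0 := by exact_mod_cast hz
  have hsum : d₀ + d₁ + t = 0 := by simpa [hδ] using hz'
  obtain ⟨x₀, e₀, hx₀, he₀, hw₀⟩ := exists_product_of_det_eq_zero (W.col 0)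
    (Complex.normSq_eq_zero.mp (by linarith : d₀ = 0)) (hnorm 0)
  obtain ⟨x₁, e₁, hx₁, he₁, hw₁⟩ := exists_product_of_det_eq_zero (W.col 1)
    (Complex.normSq_eq_zero.mp (by linarith : d₁ = 0)) (hnorm 1)
  have ht0 : t = 0 := by linarith
  have hcross : ∀ a a', star (x₀ a) * x₁ a' * (star e₀ ⬝ᵥ e₁) = 0 := by
    intro a a'
    have h := (Finset.sum_eq_zero_iff_of_nonneg fun _ _ =>
      Finset.sum_nonneg fun _ _ => Complex.normSq_nonneg _).mp ht0 a (Finset.mem_univ a)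
    have h' := Complex.normSq_eq_zero.mp ((Finset.sum_eq_zero_iff_of_nonneg fun _ _ =>
      Complex.normSq_nonneg _).mp h a' (Finset.mem_univ a'))
    rw [← h', dotProduct, Finset.mul_sum, hw₀, hw₁]
    refine Finset.sum_congr rfl fun b _ => ?_
    simp only [Pi.star_apply, star_mul']
    ring
  refine ⟨![x₀, x₁], ![e₀, e₁], ?_, ?_, ?_, ?_⟩
  · exact Fin.forall_fin_two.mpr ⟨hx₀, hx₁⟩
  · exact Fin.forall_fin_two.mpr ⟨he₀, he₁⟩
  · obtain ⟨a, ha⟩ : ∃ a, x₀ a ≠ 0 := by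
      by_contra! h
      simp [funext h] at hx₀
    obtain ⟨a', ha'⟩ : ∃ a, x₁ a ≠ 0 := by
      by_contra! h
      simp [funext h] at hx₁
    simpa [ha, ha'] using hcross a a'
  · rw [← hWV]
    have : productColumns ![x₀, x₁] ![e₀, e₁] = W := by
      ext q k
      fin_cases k
      · simpa [productColumns] using (congrFun hw₀ q).symm
      · simpa [productColumns] using (congrFun hw₁ q).symm
    rw [this]

/-- `ρ` is a proper mixture of two product states with orthonormal second factors. -/
def IsClassicalOnB (ρ : Matrix (Fin 2 × Fin 2) (Fin 2 × Fin 2) ℂ) : Prop :=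
  ∃ (ψ₀ ψ₁ e₀ e₁ : Fin 2 → ℂ) (lam : ℝ),
    0 < lam ∧ lam < 1 ∧
    dotProduct (star ψ₀) ψ₀ = 1 ∧ dotProduct (star ψ₁) ψ₁ = 1 ∧
    dotProduct (star e₀) e₀ = 1 ∧ dotProduct (star e₁) e₁ = 1 ∧
    dotProduct (star e₀) e₁ = 0 ∧
    ρ = (lam : ℂ) •
        vecMulVec (fun x : Fin 2 × Fin 2 => ψ₀ x.1 * e₀ x.2)
          (star fun x : Fin 2 × Fin 2 => ψ₀ x.1 * e₀ x.2) +
      ((1 - lam : ℝ) : ℂ) •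
        vecMulVec (fun x : Fin 2 × Fin 2 => ψ₁ x.1 * e₁ x.2)
          (star fun x : Fin 2 × Fin 2 => ψ₁ x.1 * e₁ x.2)

lemma rank_smul_vecMulVec_le {n : Type*} [Fintype n] (c : ℂ) (u v : n → ℂ) :
    (c • vecMulVec u v).rank ≤ 1 := by
  rw [← smul_vecMulVec]
  exact Matrix.rank_vecMulVec_le _ _

lemma isClassicalOnB_of_diagonal {ρ : Matrix (Fin 2 × Fin 2) (Fin 2 × Fin 2) ℂ}
    (hρ : ρ.PosSemidef) (hρtr : ρ.trace = 1) (hrank : 2 ≤ ρ.rank)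
    {x e : Fin 2 → Fin 2 → ℂ} (hx : ∀ k, star (x k) ⬝ᵥ x k = 1)
    (he : ∀ k, star (e k) ⬝ᵥ e k = 1) (horth : star (e 0) ⬝ᵥ e 1 = 0) (μ : Fin 2 → ℝ)
    (h : ρ = productColumns x e * diagonal (fun k => (μ k : ℂ)) * (productColumns x e)ᴴ) :
    IsClassicalOnB ρ := by
  have hiso := productColumns_isometry hx he horth
  set Y := productColumns x e with hY
  have hdiag : Yᴴ * ρ * Y = diagonal (fun k => (μ k : ℂ)) := by
    calc Yᴴ * ρ * Y = (Yᴴ * Y) * diagonal (fun k => (μ k : ℂ)) * (Yᴴ * Y) := by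
          rw [h]; simp only [Matrix.mul_assoc]
      _ = _ := by rw [hiso, Matrix.one_mul, Matrix.mul_one]
  have hμ (k : Fin 2) : 0 ≤ μ k := by
    have := (hρ.conjTranspose_mul_mul_same Y).diag_nonneg (i := k)
    rw [hdiag, diagonal_apply_eq] at this
    exact_mod_cast this
  have hsum : μ 0 + μ 1 = 1 := by
    rw [h, Matrix.trace_mul_comm, ← Matrix.mul_assoc, hiso, Matrix.one_mul] at hρtr
    simp only [Matrix.trace, Matrix.diag, diagonal_apply_eq, Fin.sum_univ_two] at hρtr
    exact_mod_cast hρtr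
  rw [mul_diagonal_mul_conjTranspose_fin_two] at h
  have hμ₀ : μ 0 ≠ 0 := by
    intro h0
    rw [h0, Complex.ofReal_zero, zero_smul, zero_add] at h
    have := rank_smul_vecMulVec_le (μ 1 : ℂ) (Y.col 1) (star (Y.col 1))
    rw [← h] at this
    omega
  have hμ₁ : μ 1 ≠ 0 := by
    intro h0
    rw [h0, Complex.ofReal_zero, zero_smul, add_zero] at h
    have := rank_smul_vecMulVec_le (μ 0 : ℂ) (Y.col 0) (star (Y.col 0))
    rw [← h] at this
    omega
  have hpos₀ := (hμ 0).lt_of_ne' hμ₀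
  have hpos₁ := (hμ 1).lt_of_ne' hμ₁
  refine ⟨x 0, x 1, e 0, e 1, μ 0, hpos₀, by linarith, hx 0, hx 1, he 0, he 1, horth, ?_⟩
  rw [show 1 - μ 0 = μ 1 by linarith]
  exact h

lemma eq_smul_of_normSq_eq_one {n : Type*} [Fintype n] {x y : n → ℂ} (hx : star x ⬝ᵥ x = 1)
    (hy : star y ⬝ᵥ y = 1) (h : (star x ⬝ᵥ y) * (star y ⬝ᵥ x) = 1) :
    y = (star x ⬝ᵥ y) • x := by
  rw [← sub_eq_zero, ← dotProduct_star_self_eq_zero]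
  have hc : star (star x ⬝ᵥ y) = star y ⬝ᵥ x := (star_dotProduct y x).symm
  simp only [star_sub, star_smul, sub_dotProduct, dotProduct_sub, smul_dotProduct, dotProduct_smul,
    hc, smul_eq_mul, hx, hy]
  linear_combination -h

lemma isClassicalOnB_of_supported {ρ : Matrix (Fin 2 × Fin 2) (Fin 2 × Fin 2) ℂ}
    (hρ : ρ.PosSemidef) (hρtr : ρ.trace = 1) (hrank : 2 ≤ ρ.rank) (hgap : purityGap ρ ρ = 0)
    {x e : Fin 2 → Fin 2 → ℂ} (hx : ∀ k, star (x k) ⬝ᵥ x k = 1)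
    (he : ∀ k, star (e k) ⬝ᵥ e k = 1) (horth : star (e 0) ⬝ᵥ e 1 = 0)
    (hsupp : ρ * (productColumns x e * (productColumns x e)ᴴ) = ρ) :
    IsClassicalOnB ρ := by
  have hiso := productColumns_isometry hx he horth
  set W := productColumns x e with hW
  have hR : (Wᴴ * ρ * W).IsHermitian := isHermitian_conjTranspose_mul_mul W hρ.1
  have hsupp' : W * Wᴴ * ρ = ρ := by
    have := congrArg (fun Y => Yᴴ) hsupp
    simpa [conjTranspose_mul, hρ.1.eq, Matrix.mul_assoc] using this
  have hρR : ρ = W * (Wᴴ * ρ * W) * Wᴴ := by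
    conv_lhs => rw [← hsupp, ← hsupp']
    simp only [Matrix.mul_assoc]
  rw [hρR, purityGap_productColumns hx he horth, ← hR.apply 1 0] at hgap
  by_cases h01 : (Wᴴ * ρ * W) 0 1 = 0
  · have hdiag : Wᴴ * ρ * W = diagonal fun k => (((Wᴴ * ρ * W) k k).re : ℂ) := by
      ext i j
      fin_cases i <;> fin_cases j
      · simpa using (hR.coe_re_apply_self 0).symm
      · simpa using h01
      · have := hR.apply 1 0
        rw [h01, star_zero] at this
        simpa using this.symm
      · simpa using (hR.coe_re_apply_self 1).symm
    rw [hdiag] at hρR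
    exact isClassicalOnB_of_diagonal hρ hρtr hrank hx he horth _ hρR
  · have hc : (star (x 0) ⬝ᵥ x 1) * (star (x 1) ⬝ᵥ x 0) = 1 := by
      simp only [mul_eq_zero, star_eq_zero, h01, OfNat.ofNat_ne_zero, or_self, false_or] at hgap
      exact (sub_eq_zero.mp hgap).symm
    have hx₁ := eq_smul_of_normSq_eq_one (hx 0) (hx 1) hc
    obtain ⟨U, μ, hU, -, h⟩ := hρ.1.exists_diagonal_of_isometry W hsupp
    set f : Fin 2 → Fin 2 → ℂ := fun k b => U 0 k * e 0 b + (star (x 0) ⬝ᵥ x 1) * U 1 k * e 1 b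
      with hf
    have hWU : W * U = productColumns (fun _ => x 0) f := by
      ext q k
      have := congrFun hx₁ q.1
      simp only [Pi.smul_apply, smul_eq_mul] at this
      simp only [Matrix.mul_apply, Fin.sum_univ_two, hW, productColumns, of_apply, hf]
      linear_combination e 1 q.2 * U 1 k * this
    have hff (i j : Fin 2) : star (f i) ⬝ᵥ f j = (1 : Matrix (Fin 2) (Fin 2) ℂ) i j := by
      have h1 : (W * U)ᴴ * (W * U) = 1 := by
        rw [conjTranspose_mul, Matrix.mul_assoc, ← Matrix.mul_assoc Wᴴ, hiso, Matrix.one_mul, hU]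
      rw [← h1, hWU, conjTranspose_productColumns_mul_self, hx, one_mul]
    rw [hWU] at h
    exact isClassicalOnB_of_diagonal hρ hρtr hrank (fun _ => hx 0) (fun k => by simp [hff])
      (by simp [hff]) μ h

/-- A rank-two state of vanishing purity gap which is a nontrivial mixture of states of vanishing
purity gap is classical on the second factor. -/
lemma isClassicalOnB_of_sum {ρ : Matrix (Fin 2 × Fin 2) (Fin 2 × Fin 2) ℂ}
    (hρ : ρ.PosSemidef) (hρtr : ρ.trace = 1) (hrank : ρ.rank = 2) (hgap : purityGap ρ ρ = 0)
    {n : ℕ} (p : Fin n → ℝ) (ρs : Fin n → Matrix (Fin 2 × Fin 2) (Fin 2 × Fin 2) ℂ)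
    (hp : ∀ j, 0 ≤ p j) (hp1 : ∑ j, p j = 1) (hρs : ∀ j, (ρs j).PosSemidef)
    (hρstr : ∀ j, (ρs j).trace = 1) (hgaps : ∀ j, purityGap (ρs j) (ρs j) = 0)
    (hsum : ρ = ∑ j, (p j : ℂ) • ρs j) (hne : ∃ j, 0 < p j ∧ ρs j ≠ ρ) :
    IsClassicalOnB ρ := by
  obtain ⟨V, hV, hρV⟩ := hρ.1.exists_isometry hrank
  have hsupp (j) (hj : 0 < p j) : (ρs j - ρ) * (V * Vᴴ) = ρs j - ρ := by
    rw [sub_mul, hρV, mul_eq_self_of_sum p ρs hp hρs (V * Vᴴ)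
      (isHermitian_mul_conjTranspose_self V) (hsum ▸ hρV) j hj]
  have hkey (j) (hj : 0 < p j) := purityGap_nonneg_of_trace_eq_zero ((hρs j).1.sub hρ.1)
    (by rw [Matrix.trace_sub, hρstr, hρtr, sub_self]) V hV (hsupp j hj)
  have hzero : ∑ j, (p j : ℂ) * purityGap (ρs j - ρ) (ρs j - ρ) = 0 := by
    rw [sum_mul_purityGap_sub p hp1 ρs ρ hsum, hgap]
    simp [hgaps]
  have hnn : ∀ j ∈ Finset.univ, 0 ≤ (p j : ℂ) * purityGap (ρs j - ρ) (ρs j - ρ) := by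
    intro j _
    rcases (hp j).eq_or_lt with h0 | h0
    · simp [← h0]
    · exact mul_nonneg (by exact_mod_cast hp j) (hkey j h0).1
  obtain ⟨j, hj, hjne⟩ := hne
  have hpj : (p j : ℂ) ≠ 0 := by exact_mod_cast hj.ne'
  have hjzero := (mul_eq_zero.mp ((Finset.sum_eq_zero_iff_of_nonneg hnn).mp hzero j
    (Finset.mem_univ j))).resolve_left hpj
  obtain ⟨x, e, hx, he, horth, hVV⟩ := (hkey j hj).2 hjzero (sub_ne_zero.mpr hjne)
  exact isClassicalOnB_of_supported hρ hρtr hrank.ge hgap hx he horth (hVV ▸ hρV)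

lemma trace_vecMulVec_product {A B : Type*} [Fintype A] [Fintype B] {ψ : A → ℂ} {φ : B → ℂ}
    (hψ : star ψ ⬝ᵥ ψ = 1) (hφ : star φ ⬝ᵥ φ = 1) :
    (vecMulVec (fun x : A × B => ψ x.1 * φ x.2)
      (star fun x : A × B => ψ x.1 * φ x.2)).trace = 1 := by
  have := conjTranspose_productColumns_mul_self (fun _ : Unit => ψ) (fun _ : Unit => φ) () ()
  rw [hψ, hφ, one_mul] at this
  rw [trace_vecMulVec, dotProduct_comm, ← this]
  rfl

/-- For a mixed pure-extendible two-qubit state the following are equivalent: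
(1) it is a nontrivial convex combination of pure-extendible states,
(2) it is separable, (3) it has the special classical-on-`B` form. -/
theorem stmt_7
    (ρ : Matrix (Fin 2 × Fin 2) (Fin 2 × Fin 2) ℂ)
    (hρ : ρ.PosSemidef) (hρtr : ρ.trace = 1)
    (hmixed : 2 ≤ ρ.rank) (hpure : PureExt ρ) :
    ((∃ (n : ℕ) (p : Fin n → ℝ) (ρs : Fin n → Matrix (Fin 2 × Fin 2) (Fin 2 × Fin 2) ℂ),
        (∀ j, 0 < p j) ∧ (∑ j, p j = 1) ∧
        (∀ j, (ρs j).PosSemidef ∧ (ρs j).trace = 1 ∧ PureExt (ρs j)) ∧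
        ρ = ∑ j, (p j : ℂ) • ρs j ∧ (∃ j, ρs j ≠ ρ)) ↔
      (∃ (n : ℕ) (p : Fin n → ℝ) (ψ φ : Fin n → (Fin 2 → ℂ)),
        (∀ j, 0 ≤ p j) ∧ (∑ j, p j = 1) ∧
        (∀ j, dotProduct (star (ψ j)) (ψ j) = 1 ∧ dotProduct (star (φ j)) (φ j) = 1) ∧
        ρ = ∑ j, (p j : ℂ) •
          vecMulVec (fun x : Fin 2 × Fin 2 => ψ j x.1 * φ j x.2)
            (star fun x : Fin 2 × Fin 2 => ψ j x.1 * φ j x.2))) ∧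
    ((∃ (n : ℕ) (p : Fin n → ℝ) (ψ φ : Fin n → (Fin 2 → ℂ)),
        (∀ j, 0 ≤ p j) ∧ (∑ j, p j = 1) ∧
        (∀ j, dotProduct (star (ψ j)) (ψ j) = 1 ∧ dotProduct (star (φ j)) (φ j) = 1) ∧
        ρ = ∑ j, (p j : ℂ) •
          vecMulVec (fun x : Fin 2 × Fin 2 => ψ j x.1 * φ j x.2)
            (star fun x : Fin 2 × Fin 2 => ψ j x.1 * φ j x.2)) ↔
      (∃ (ψ₀ ψ₁ e₀ e₁ : Fin 2 → ℂ) (lam : ℝ),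
        0 < lam ∧ lam < 1 ∧
        dotProduct (star ψ₀) ψ₀ = 1 ∧ dotProduct (star ψ₁) ψ₁ = 1 ∧
        dotProduct (star e₀) e₀ = 1 ∧ dotProduct (star e₁) e₁ = 1 ∧
        dotProduct (star e₀) e₁ = 0 ∧
        ρ = (lam : ℂ) •
            vecMulVec (fun x : Fin 2 × Fin 2 => ψ₀ x.1 * e₀ x.2)
              (star fun x : Fin 2 × Fin 2 => ψ₀ x.1 * e₀ x.2) +
          ((1 - lam : ℝ) : ℂ) •
            vecMulVec (fun x : Fin 2 × Fin 2 => ψ₁ x.1 * e₁ x.2)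
              (star fun x : Fin 2 × Fin 2 => ψ₁ x.1 * e₁ x.2))) := by
  have hgap := hpure.purityGap_self
  have hrank : ρ.rank = 2 := le_antisymm (by simpa using hpure.rank_le) hmixed
  have hprod (ψ φ : Fin 2 → ℂ) (hψ : star ψ ⬝ᵥ ψ = 1) (hφ : star φ ⬝ᵥ φ = 1) :
      vecMulVec (fun x : Fin 2 × Fin 2 => ψ x.1 * φ x.2)
        (star fun x : Fin 2 × Fin 2 => ψ x.1 * φ x.2) ≠ ρ := by
    rintro rfl
    exact absurd (hmixed.trans (Matrix.rank_vecMulVec_le _ _)) (by norm_num)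
  suffices h13 : _ → IsClassicalOnB ρ by
    suffices h23 : _ → IsClassicalOnB ρ by
      suffices h31 : IsClassicalOnB ρ → _ by
        suffices h32 : IsClassicalOnB ρ → _ from
          ⟨⟨h32 ∘ h13, h31 ∘ h23⟩, ⟨h23, h32⟩⟩
        rintro ⟨ψ₀, ψ₁, e₀, e₁, lam, h0, h1, hψ₀, hψ₁, he₀, he₁, -, h⟩
        refine ⟨2, ![lam, 1 - lam], ![ψ₀, ψ₁], ![e₀, e₁],
          Fin.forall_fin_two.mpr ⟨h0.le, (sub_pos.mpr h1).le⟩, by simp,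
          Fin.forall_fin_two.mpr ⟨⟨hψ₀, he₀⟩, ⟨hψ₁, he₁⟩⟩, ?_⟩
        rw [Fin.sum_univ_two]
        exact h
      rintro ⟨ψ₀, ψ₁, e₀, e₁, lam, h0, h1, hψ₀, hψ₁, he₀, he₁, -, h⟩
      refine ⟨2, ![lam, 1 - lam], ![_, _],
        Fin.forall_fin_two.mpr ⟨h0, sub_pos.mpr h1⟩, by simp,
        Fin.forall_fin_two.mpr
          ⟨⟨posSemidef_vecMulVec_self_star _, trace_vecMulVec_product hψ₀ he₀,
            pureExt_product ψ₀ e₀ hψ₀ he₀⟩,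
          ⟨posSemidef_vecMulVec_self_star _, trace_vecMulVec_product hψ₁ he₁,
            pureExt_product ψ₁ e₁ hψ₁ he₁⟩⟩, ?_, 0, hprod ψ₀ e₀ hψ₀ he₀⟩
      rw [Fin.sum_univ_two]
      exact h
    rintro ⟨n, p, ψ, φ, hp, hp1, hunit, h⟩
    obtain ⟨j, -, hj⟩ := Finset.exists_lt_of_sum_lt (s := Finset.univ) (f := fun _ => (0 : ℝ))
      (g := p) (by simp [hp1])
    exact isClassicalOnB_of_sum hρ hρtr hrank hgap p _ hp hp1
      (fun j => posSemidef_vecMulVec_self_star _)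
      (fun j => trace_vecMulVec_product (hunit j).1 (hunit j).2)
      (fun j => (pureExt_product _ _ (hunit j).1 (hunit j).2).purityGap_self) h
      ⟨j, hj, hprod _ _ (hunit j).1 (hunit j).2⟩
  rintro ⟨n, p, ρs, hp, hp1, hρs, h, j, hj⟩
  exact isClassicalOnB_of_sum hρ hρtr hrank hgap p ρs (fun j => (hp j).le) hp1
    (fun j => (hρs j).1) (fun j => (hρs j).2.1) (fun j => (hρs j).2.2.purityGap_self) h
    ⟨j, hp j, hj⟩
end
end
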